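/- When real quadratic fields are ordered by discriminant, a density of 0% of them have a unit of mixed signature; that is, lim_{X→∞} #{real quadratic F : Disc(F)<X, O_F has a unit of mixed signature} / #{real quadratic F : Disc(F)<X} = 0. -/

import Mathlib

open NumberField Filter Topology
open scoped nonZeroDivisors Classical

noncomputable section

/-- The setoid of subfields of `ℂ` (finite over `ℚ` or not), up to `ℚ`-algebra isomorphism. -/
def isoSetoid : Setoid (IntermediateField ℚ ℂ) where
  r K L := Nonempty (↥K ≃ₐ[ℚ] ↥L)
  iseqv := ⟨fun _ => ⟨AlgEquiv.refl⟩, fun ⟨e⟩ => ⟨e.symm⟩, fun ⟨e⟩ ⟨f⟩ => ⟨e.trans f⟩⟩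

/-- Isomorphism classes of subfields of `ℂ`; since every number field embeds into `ℂ`,
every isomorphism class of number fields is represented here. -/
abbrev FieldClass : Type := Quotient isoSetoid

/-- `K` is a cubic field. -/
def IsCubic (K : IntermediateField ℚ ℂ) : Prop := Module.finrank ℚ ↥K = 3

/-- `K` (cubic) is totally real: it has three real embeddings. -/
def IsTotallyRealCubic (K : IntermediateField ℚ ℂ) : Prop :=
  Module.finrank ℚ ↥K = 3 ∧ Nat.card (↥K →+* ℝ) = 3

/-- `K` is a complex cubic field: cubic with exactly one real embedding. -/
def IsComplexCubic (K : IntermediateField ℚ ℂ) : Prop :=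
  Module.finrank ℚ ↥K = 3 ∧ Nat.card (↥K →+* ℝ) = 1

/-- `K` is a real quadratic field. -/
def IsRealQuadratic (K : IntermediateField ℚ ℂ) : Prop :=
  Module.finrank ℚ ↥K = 2 ∧ Nat.card (↥K →+* ℝ) = 2

/-- The discriminant of a subfield of `ℂ` that is a number field (junk value `0` otherwise). -/
def intDisc (K : IntermediateField ℚ ℂ) : ℤ :=
  letI : CharZero ↥K := charZero_of_injective_algebraMap (algebraMap ℚ ↥K).injective
  if h : FiniteDimensional ℚ ↥K then
    letI := h
    letI : NumberField ↥K := ⟨⟩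
    NumberField.discr ↥K
  else 0

/-- The absolute value of the discriminant. -/
def absDisc (K : IntermediateField ℚ ℂ) : ℕ := (intDisc K).natAbs

/-- The class number `|Cl(K)|`. -/
def clCard (K : IntermediateField ℚ ℂ) : ℕ := Nat.card (ClassGroup (𝓞 ↥K))

/-- The number of 2-torsion elements of the class group. -/
def cl2Card (K : IntermediateField ℚ ℂ) : ℕ :=
  Nat.card {c : ClassGroup (𝓞 ↥K) // c ^ 2 = 1}

/-- The narrow class group of a number field `K`: the quotient of the group of invertible
fractional ideals of `𝓞 K` by the subgroup generated by principal fractional ideals with a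
totally positive generator. -/
abbrev narrowClassGroup (K : Type*) [Field K] [NumberField K] : Type _ :=
  (FractionalIdeal (𝓞 K)⁰ K)ˣ ⧸
    Subgroup.closure {I : (FractionalIdeal (𝓞 K)⁰ K)ˣ |
      ∃ x : Kˣ, (∀ σ : K →+* ℝ, 0 < σ (x : K)) ∧ toPrincipalIdeal (𝓞 K) K x = I}

/-- The cardinality of the narrow class group (junk value `0` if not a number field). -/
def clPlusCard (K : IntermediateField ℚ ℂ) : ℕ :=
  letI : CharZero ↥K := charZero_of_injective_algebraMap (algebraMap ℚ ↥K).injective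
  if h : FiniteDimensional ℚ ↥K then
    letI := h
    letI : NumberField ↥K := ⟨⟩
    Nat.card (narrowClassGroup ↥K)
  else 0

/-- The number of 2-torsion elements of the narrow class group. -/
def cl2PlusCard (K : IntermediateField ℚ ℂ) : ℕ :=
  letI : CharZero ↥K := charZero_of_injective_algebraMap (algebraMap ℚ ↥K).injective
  if h : FiniteDimensional ℚ ↥K then
    letI := h
    letI : NumberField ↥K := ⟨⟩
    Nat.card {c : narrowClassGroup ↥K // c ^ 2 = 1}
  else 0

/-- The number of isomorphism classes of number fields (as subfields of `ℂ`) satisfying an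
isomorphism-invariant predicate `P`. -/
def classCount (P : IntermediateField ℚ ℂ → Prop) : ℕ :=
  Nat.card {c : FieldClass // P c.out}

end

noncomputable section

/-- `O_K` has a unit of mixed signature: some unit is positive under some real embedding
and negative under another. -/
def HasMixedUnit (K : IntermediateField ℚ ℂ) : Prop :=
  ∃ u : (𝓞 ↥K)ˣ, (∃ σ : ↥K →+* ℝ, 0 < σ (algebraMap (𝓞 ↥K) ↥K ↑u)) ∧
    (∃ σ : ↥K →+* ℝ, σ (algebraMap (𝓞 ↥K) ↥K ↑u) < 0)

/-- The signature map `sgn : O_K^× → {±1}^r` is surjective: every possible signature is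
realized by a unit. -/
def SignSurjective (K : IntermediateField ℚ ℂ) : Prop :=
  ∀ ε : (↥K →+* ℝ) → ℝ, (∀ σ, ε σ = 1 ∨ ε σ = -1) →
    ∃ u : (𝓞 ↥K)ˣ, ∀ σ : ↥K →+* ℝ, Real.sign (σ (algebraMap (𝓞 ↥K) ↥K ↑u)) = ε σ

end

open ArithmeticFunction.vonMangoldt in
/-- The reciprocals of the primes in an invertible residue class have divergent sum. -/
theorem not_summable_inv_prime_residueClass {q : ℕ} [NeZero q] {a : ZMod q} (ha : IsUnit a) :
    ¬ Summable fun n : ℕ ↦ if n.Prime ∧ (n : ZMod q) = a then (n : ℝ)⁻¹ else 0 := by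
  intro H
  obtain ⟨C, hC⟩ := LSeries_residueClass_lower_bound ha
  have hbound := (summable_residueClass_non_primes_div a).add H
  have hdom : Tendsto (fun x : ℝ ↦ ∑' n : ℕ, (x - 1) * (residueClass a n / (n : ℝ) ^ x))
      (𝓝[>] 1) (𝓝 (∑' _ : ℕ, (0 : ℝ))) := by
    refine tendsto_tsum_of_dominated_convergence hbound (fun n ↦ ?_) ?_
    · rcases Nat.eq_zero_or_pos n with rfl | hn
      · simp
      have hc : ContinuousAt (fun x : ℝ ↦ (x - 1) * (residueClass a n / (n : ℝ) ^ x)) 1 := by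
        have : (n : ℝ) ≠ 0 := by positivity
        have h2 : (n : ℝ) ^ (1 : ℝ) ≠ 0 := by simpa
        exact (continuousAt_id.sub continuousAt_const).mul
          (continuousAt_const.div (Real.continuousAt_const_rpow this) h2)
      have := hc.tendsto
      simp only [sub_self, zero_mul] at this
      exact this.mono_left nhdsWithin_le_nhds
    · filter_upwards [Ioc_mem_nhdsGT (show (1 : ℝ) < 2 by norm_num)] with x hx n
      obtain ⟨hx1, hx2⟩ := hx
      rcases Nat.eq_zero_or_pos n with rfl | hn
      · simp
      have hn1 : (1 : ℝ) ≤ n := by exact_mod_cast hn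
      have hpow : (n : ℝ) ^ x = n * (n : ℝ) ^ (x - 1) := by
        rw [← Real.rpow_one_add' (by positivity) (by linarith)]; ring_nf
      have hpos : 0 < (n : ℝ) ^ (x - 1) := by positivity
      have hge : 1 ≤ (n : ℝ) ^ (x - 1) := Real.one_le_rpow hn1 (by linarith)
      have hr := residueClass_nonneg a n
      rw [Real.norm_of_nonneg (mul_nonneg (by linarith) (by positivity)), hpow]
      by_cases hp : n.Prime
      · by_cases hna : (n : ZMod q) = a
        · have hval : residueClass a n = Real.log n := by
            rw [residueClass, Set.indicator_of_mem (by exact hna),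
              ArithmeticFunction.vonMangoldt_apply_prime hp]
          have hlog := Real.log_le_rpow_div (x := n) (by positivity) (sub_pos.2 hx1)
          rw [le_div_iff₀ (sub_pos.2 hx1)] at hlog
          simp only [hp, hna, and_self, if_true, zero_div, zero_add, hval]
          rw [← mul_div_assoc, div_le_iff₀ (by positivity)]
          field_simp
          linarith
        · simp [hna]
      · simp only [hp, if_false, false_and, add_zero]
        rw [← mul_div_assoc]
        apply div_le_div₀ hr _ (by positivity) _
        · nlinarith
        · nlinarith
  simp only [tsum_zero, tsum_mul_left] at hdom
  have hlow : Tendsto (fun x : ℝ ↦ (q.totient : ℝ)⁻¹ - C * (x - 1)) (𝓝[>] 1)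
      (𝓝 (q.totient : ℝ)⁻¹) := by
    have : Continuous (fun x : ℝ ↦ (q.totient : ℝ)⁻¹ - C * (x - 1)) := by fun_prop
    simpa using (this.tendsto 1).mono_left nhdsWithin_le_nhds
  have hle : (q.totient : ℝ)⁻¹ ≤ 0 := by
    refine le_of_tendsto_of_tendsto hlow hdom ?_
    filter_upwards [Ioc_mem_nhdsGT (show (1 : ℝ) < 2 by norm_num)] with x hx
    have hx0 : 0 < x - 1 := sub_pos.2 hx.1
    have := mul_le_mul_of_nonneg_left (hC hx) hx0.le
    calc _ = (x - 1) * ((q.totient : ℝ)⁻¹ / (x - 1) - C) := by field_simp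
      _ ≤ _ := this
  have : 0 < (q.totient : ℝ)⁻¹ := inv_pos.mpr (mod_cast q.totient.pos_of_neZero)
  linarith

/-- For a residue class `a` mod `q` that is invertible, there are moduli `Q`, all of whose prime
factors lie in the class `a`, with arbitrarily small `φ(Q) / Q`. -/
theorem exists_totient_le_mul {q : ℕ} [NeZero q] {a : ZMod q} (ha : IsUnit a) {ε : ℝ}
    (hε : 0 < ε) :
    ∃ Q : ℕ, Q ≠ 0 ∧ (∀ p : ℕ, p.Prime → p ∣ Q → (p : ZMod q) = a) ∧
      (Q.totient : ℝ) ≤ ε * Q := by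
  have hdiv := (not_summable_iff_tendsto_nat_atTop_of_nonneg
    (fun n ↦ by positivity)).1 (not_summable_inv_prime_residueClass ha)
  obtain ⟨N, hN⟩ := (hdiv.eventually_ge_atTop (-Real.log ε)).exists
  set T := (Finset.range N).filter (fun n : ℕ ↦ n.Prime ∧ (n : ZMod q) = a) with hT
  have hTp : ∀ p ∈ T, p.Prime := fun p hp ↦ (Finset.mem_filter.1 hp).2.1
  rw [← Finset.sum_filter, ← hT] at hN
  refine ⟨∏ p ∈ T, p, Finset.prod_ne_zero_iff.2 fun p hp ↦ (hTp p hp).ne_zero, ?_, ?_⟩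
  · intro p hp hdvd
    obtain ⟨r, hr, hpr⟩ := (hp.prime.dvd_finsetProd_iff _).1 hdvd
    rw [(Nat.prime_dvd_prime_iff_eq hp (hTp r hr)).1 hpr]
    exact (Finset.mem_filter.1 hr).2.2
  · have htot := Nat.totient_eq_mul_prod_factors (∏ p ∈ T, p)
    rw [Nat.primeFactors_prod hTp] at htot
    have htot' : ((∏ p ∈ T, p).totient : ℝ) = (∏ p ∈ T, p : ℕ) * ∏ p ∈ T, (1 - (p : ℝ)⁻¹) := by
      have := congrArg (Rat.cast : ℚ → ℝ) htot
      push_cast at this ⊢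
      exact this
    rw [htot', mul_comm]
    gcongr
    calc ∏ p ∈ T, (1 - (p : ℝ)⁻¹) ≤ ∏ p ∈ T, Real.exp (-(p : ℝ)⁻¹) := by
          refine Finset.prod_le_prod (fun p hp ↦ ?_) fun p _ ↦ Real.one_sub_le_exp_neg _
          exact sub_nonneg.2 (inv_le_one_of_one_le₀ (mod_cast (hTp p hp).one_le))
      _ = Real.exp (-∑ p ∈ T, (p : ℝ)⁻¹) := by
          rw [← Real.exp_sum, Finset.sum_neg_distrib]
      _ ≤ Real.exp (Real.log ε) := Real.exp_le_exp.2 (by linarith)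
      _ = ε := Real.exp_log hε

theorem sum_Icc_two_inv_sq_le (N : ℕ) : ∑ k ∈ Finset.Icc 2 N, ((k : ℝ) ^ 2)⁻¹ ≤ 3 / 4 := by
  rcases lt_or_ge N 2 with hN | hN
  · rw [Finset.Icc_eq_empty (by lia)]; norm_num
  suffices ∑ k ∈ Finset.Icc 2 N, ((k : ℝ) ^ 2)⁻¹ ≤ 3 / 4 - (N : ℝ)⁻¹ from
    this.trans (by simp)
  induction N, hN using Nat.le_induction with
  | base => norm_num
  | succ n hn ih =>
    rw [Finset.sum_Icc_succ_top (by lia)]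
    have hn0 : (0 : ℝ) < n := by exact_mod_cast (by lia : 0 < n)
    have : (((n + 1 : ℕ) : ℝ) ^ 2)⁻¹ ≤ (n : ℝ)⁻¹ - ((n + 1 : ℕ) : ℝ)⁻¹ := by
      push_cast
      rw [inv_sub_inv (by positivity) (by positivity), inv_eq_one_div,
        div_le_div_iff₀ (by positivity) (by positivity)]
      nlinarith
    linarith

/-- At least a quarter of the integers in `[1, N]` are squarefree. -/
theorem div_four_le_card_squarefree (N : ℕ) :
    (N : ℝ) / 4 ≤ ((Finset.Ioc 0 N).filter Squarefree).card := by
  have hcover : Finset.Ioc 0 N ⊆ (Finset.Ioc 0 N).filter Squarefree ∪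
      (Finset.Icc 2 N).biUnion fun k ↦ (Finset.Ioc 0 N).filter (k ^ 2 ∣ ·) := by
    intro n hn
    by_cases hsq : Squarefree n
    · exact Finset.mem_union_left _ (Finset.mem_filter.2 ⟨hn, hsq⟩)
    · refine Finset.mem_union_right _ ?_
      obtain ⟨p, hp, hpn⟩ : ∃ p : ℕ, p.Prime ∧ p * p ∣ n := by
        simpa [Nat.squarefree_iff_prime_squarefree] using hsq
      have hn' := Finset.mem_Ioc.1 hn
      have hle : p ≤ n := Nat.le_of_dvd hn'.1 ((dvd_mul_right p p).trans hpn)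
      simp only [Finset.mem_biUnion, Finset.mem_Icc, Finset.mem_filter]
      exact ⟨p, ⟨hp.two_le, hle.trans hn'.2⟩, hn, by rwa [sq]⟩
  have hcard := (Finset.card_le_card hcover).trans ((Finset.card_union_le _ _).trans
    (Nat.add_le_add_left Finset.card_biUnion_le _))
  have hsum : ((∑ k ∈ Finset.Icc 2 N, ((Finset.Ioc 0 N).filter (k ^ 2 ∣ ·)).card : ℕ) : ℝ) ≤
      N * (3 / 4) := by
    push_cast
    calc _ ≤ ∑ k ∈ Finset.Icc 2 N, (N : ℝ) * ((k : ℝ) ^ 2)⁻¹ := by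
          refine Finset.sum_le_sum fun k _ ↦ ?_
          rw [Nat.Ioc_filter_dvd_card_eq_div, ← div_eq_mul_inv]
          exact_mod_cast Nat.cast_div_le (α := ℝ) (m := N) (n := k ^ 2)
      _ ≤ _ := by
          rw [← Finset.mul_sum]
          exact mul_le_mul_of_nonneg_left (sum_Icc_two_inv_sq_le N) (Nat.cast_nonneg N)
  have hcard' : (N : ℝ) ≤ ((Finset.Ioc 0 N).filter Squarefree).card +
      ((∑ k ∈ Finset.Icc 2 N, ((Finset.Ioc 0 N).filter (k ^ 2 ∣ ·)).card : ℕ) : ℝ) := by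
    rw [Nat.card_Ioc] at hcard
    exact_mod_cast hcard
  linarith

/-- A squarefree natural number is determined by its class modulo nonzero rational squares. -/
theorem eq_of_squarefree_of_mul_sq_eq {a b x y : ℕ} (ha : Squarefree a) (hb : Squarefree b)
    (hx : x ≠ 0) (hy : y ≠ 0) (h : a * x ^ 2 = b * y ^ 2) : a = b := by
  refine Nat.eq_of_factorization_eq ha.ne_zero hb.ne_zero fun p ↦ ?_
  have := congrArg (fun n ↦ n.factorization p) h
  simp only [Nat.factorization_mul ha.ne_zero (pow_ne_zero 2 hx),
    Nat.factorization_mul hb.ne_zero (pow_ne_zero 2 hy), Nat.factorization_pow,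
    Finsupp.add_apply, Finsupp.smul_apply, smul_eq_mul] at this
  have h1 := ha.natFactorization_le_one p
  have h2 := hb.natFactorization_le_one p
  lia

section RankTwo

variable {R S : Type*} [CommRing R] [Nontrivial R] [CommRing S] [Algebra R S]

theorem sq_sub_trace_mul_add_norm_eq_zero (b : Module.Basis (Fin 2) R S) (α : S) :
    α ^ 2 - algebraMap R S (Algebra.trace R S α) * α + algebraMap R S (Algebra.norm R α) = 0 := by
  have h := Matrix.aeval_self_charpoly (Algebra.leftMulMatrix b α)
  rw [Matrix.charpoly_fin_two, ← Algebra.trace_eq_matrix_trace, ← Algebra.norm_eq_matrix_det,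
    Polynomial.aeval_algHom_apply] at h
  have h0 := Algebra.leftMulMatrix_injective b (h.trans (map_zero _).symm)
  simpa using h0

theorem discr_one_self (b : Module.Basis (Fin 2) R S) (α : S) :
    Algebra.discr R ![1, α] = Algebra.trace R S α ^ 2 - 4 * Algebra.norm R α := by
  have h := sq_sub_trace_mul_add_norm_eq_zero b α
  have h1 : Algebra.trace R S 1 = 2 := by
    rw [Algebra.trace_eq_matrix_trace b]; simp
  have h2 : Algebra.trace R S (α * α) =
      Algebra.trace R S α ^ 2 - 2 * Algebra.norm R α := by
    have h3 : α * α = Algebra.trace R S α • α - Algebra.norm R α • (1 : S) := by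
      simp only [Algebra.smul_def, mul_one]
      linear_combination h
    nth_rw 1 [h3]
    rw [map_sub, map_smul, map_smul, h1, smul_eq_mul, smul_eq_mul]
    ring
  rw [Algebra.discr_def, Matrix.det_fin_two]
  simp only [Algebra.traceMatrix_apply, Algebra.traceForm_apply, Matrix.cons_val_zero,
    Matrix.cons_val_one, one_mul, mul_one, h1, h2]
  ring

theorem exists_trace_sq_sub_norm_eq (b : Module.Basis (Fin 2) R S) (α : S) :
    ∃ f : R, Algebra.trace R S α ^ 2 - 4 * Algebra.norm R α = f ^ 2 * Algebra.discr R b := by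
  refine ⟨(b.toMatrix ![1, α]).transpose.det, ?_⟩
  rw [← discr_one_self b, ← Algebra.discr_of_matrix_mulVec]
  congr 1
  ext i
  simp only [Matrix.mulVec, dotProduct, Matrix.map_apply, Matrix.transpose_apply,
    ← Algebra.smul_def, Module.Basis.sum_toMatrix_smul_self]

end RankTwo

namespace NumberField

variable {K : Type*} [Field K] [NumberField K]

/-- For an integer `α` of a quadratic field, `α² - tα + n = 0` with `t ^ 2 - 4 * n` a square
multiple of the discriminant of the field. -/
theorem exists_quadratic_relation (h2 : Module.finrank ℚ K = 2) (α : 𝓞 K) :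
    ∃ t n f : ℤ, (α : K) ^ 2 - t * α + n = 0 ∧ n = Algebra.norm ℤ α ∧
      t ^ 2 - 4 * n = f ^ 2 * discr K := by
  let b := Module.finBasisOfFinrankEq ℤ (𝓞 K) ((RingOfIntegers.rank K).trans h2)
  obtain ⟨f, hf⟩ := exists_trace_sq_sub_norm_eq b α
  refine ⟨_, _, f, ?_, rfl, by rw [hf, discr_eq_discr]⟩
  have := congrArg (algebraMap (𝓞 K) K) (sq_sub_trace_mul_add_norm_eq_zero b α)
  simpa using this

theorem exists_sq_eq_discr (h2 : Module.finrank ℚ K = 2) :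
    ∃ δ : K, δ ^ 2 = discr K ∧ δ ∉ Set.range (algebraMap ℚ K) := by
  obtain ⟨x, hx⟩ : ∃ x : K, x ∉ (⊥ : Subalgebra ℚ K) := by
    by_contra! h
    have h1 := Subalgebra.bot_eq_top_iff_finrank_eq_one.1 (Algebra.eq_top_iff.2 h)
    lia
  obtain ⟨α, m, hm, rfl⟩ : ∃ (α : 𝓞 K) (m : ℤ), m ≠ 0 ∧ x = (α : K) / m := by
    obtain ⟨m, hm, hint⟩ := ((IsFractionRing.isAlgebraic_iff ℤ ℚ K).2
      (Algebra.IsAlgebraic.isAlgebraic (R := ℚ) x)).exists_integral_multiple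
    refine ⟨⟨m • x, hint⟩, m, hm, ?_⟩
    have : (m : K) ≠ 0 := by exact_mod_cast hm
    simp [field]
  obtain ⟨t, n, f, hrel, -, hf⟩ := exists_quadratic_relation h2 α
  have hα : ∀ r : ℚ, (α : K) ≠ r := by
    intro r hr
    refine hx (Algebra.mem_bot.2 ⟨r / m, ?_⟩)
    simp [hr]
  have hfK : (t : K) ^ 2 - 4 * n = f ^ 2 * discr K := by exact_mod_cast congrArg (Int.cast : ℤ → K) hf
  have hsq : (2 * (α : K) - t) ^ 2 = f ^ 2 * discr K := by
    linear_combination 4 * hrel + hfK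
  have hne : ∀ r : ℚ, 2 * (α : K) - t ≠ r := by
    intro r hr
    apply hα ((r + t) / 2)
    push_cast
    linear_combination hr / 2
  have hf0 : (f : K) ≠ 0 := by
    intro h0
    rw [h0] at hsq
    apply hne 0
    have : (2 * (α : K) - t) ^ 2 = 0 := by rw [hsq]; ring
    simpa using pow_eq_zero_iff (two_ne_zero) |>.1 this
  refine ⟨(2 * α - t) / f, by rw [div_pow, hsq]; field_simp, ?_⟩
  rintro ⟨r, hr⟩
  apply hne (r * f)
  rw [eq_div_iff hf0] at hr
  push_cast
  rw [← hr]; simp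

/-- If a quadratic field has a unit that is positive and negative under two real embeddings, then
no prime congruent to `3` mod `4` divides its discriminant. -/
theorem mod_four_ne_three_of_dvd_discr (h2 : Module.finrank ℚ K = 2) (u : (𝓞 K)ˣ)
    {σ τ : K →+* ℝ} (hσ : 0 < σ (algebraMap (𝓞 K) K u)) (hτ : τ (algebraMap (𝓞 K) K u) < 0)
    {p : ℕ} (hp : p.Prime) (hpd : (p : ℤ) ∣ discr K) : p % 4 ≠ 3 := by
  obtain ⟨t, n, f, hrel, hn, hf⟩ := exists_quadratic_relation h2 (u : 𝓞 K)
  have hroot (ρ : K →+* ℝ) : ρ (u : 𝓞 K) ^ 2 - t * ρ (u : 𝓞 K) + n = 0 := by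
    simpa using congrArg ρ hrel
  have hn1 : n = 1 ∨ n = -1 := by
    rw [hn]; exact Int.isUnit_iff.1 (u.isUnit.map (Algebra.norm ℤ))
  have hnneg : (n : ℝ) < 0 := by
    set a := σ (u : 𝓞 K)
    set b := τ (u : 𝓞 K)
    have hsum : t = a + b := by
      have hab : a - b ≠ 0 := by linarith
      apply mul_left_cancel₀ hab
      linear_combination hroot τ - hroot σ
    have hroot := hroot σ
    rw [hsum] at hroot
    nlinarith [mul_neg_of_pos_of_neg hσ hτ]
  have hn2 : n = -1 := by
    rcases hn1 with h | h
    · rw [h] at hnneg; norm_num at hnneg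
    · exact h
  intro hp3
  have : Fact p.Prime := ⟨hp⟩
  have h0 : ((t ^ 2 - 4 * n : ℤ) : ZMod p) = 0 :=
    (ZMod.intCast_zmod_eq_zero_iff_dvd _ p).2 (hf ▸ hpd.mul_left _)
  have htwo : (2 : ZMod p) ≠ 0 := by
    intro h
    have : p ∣ 2 := (ZMod.natCast_eq_zero_iff 2 p).1 (by exact_mod_cast h)
    have := Nat.le_of_dvd two_pos this
    have := hp.two_le
    lia
  refine ZMod.mod_four_ne_three_of_sq_eq_neg_sq' (x := (t : ZMod p)) htwo ?_ hp3
  rw [hn2] at h0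
  push_cast at h0
  linear_combination h0

theorem exists_discr_mul_sq_eq (h2 : Module.finrank ℚ K = 2) {d : ℕ} (hd : d ≠ 0) {x : K}
    (hx : x ^ 2 = d) (hxQ : x ∉ Set.range (algebraMap ℚ K)) :
    ∃ f : ℕ, f ≠ 0 ∧ discr K * f ^ 2 = 4 * d := by
  have hint : IsIntegral ℤ x := by
    refine IsIntegral.of_pow two_pos ?_
    rw [hx]; exact_mod_cast isIntegral_algebraMap (R := ℤ) (A := K) (x := (d : ℤ))
  obtain ⟨t, n, f, hrel, -, hf⟩ := exists_quadratic_relation h2 (⟨x, hint⟩ : 𝓞 K)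
  replace hrel : x ^ 2 - t * x + n = 0 := hrel
  rw [hx] at hrel
  have ht : t = 0 := by
    by_contra ht
    have htK : (t : K) ≠ 0 := by exact_mod_cast ht
    refine hxQ ⟨((d : ℚ) + n) / t, ?_⟩
    simp only [map_div₀, map_add, map_natCast, map_intCast]
    rw [div_eq_iff htK]
    linear_combination hrel
  subst ht
  have hn : (d : ℤ) + n = 0 := by
    simp only [Int.cast_zero, zero_mul, sub_zero] at hrel
    exact_mod_cast hrel
  refine ⟨f.natAbs, ?_, ?_⟩
  · intro h0
    rw [Int.natAbs_eq_zero.1 h0] at hf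
    lia
  · rw [Int.natCast_natAbs, sq_abs]
    linear_combination -4 * hn - hf

theorem discr_pos_of_realEmbedding (h2 : Module.finrank ℚ K = 2) (σ : K →+* ℝ) : 0 < discr K := by
  obtain ⟨δ, hδ, -⟩ := exists_sq_eq_discr h2
  refine lt_of_le_of_ne ?_ (discr_ne_zero K).symm
  have : (0 : ℝ) ≤ discr K := by
    have := congrArg σ hδ
    rw [map_pow, map_intCast] at this
    rw [← this]; positivity
  exact_mod_cast this

end NumberField

section Subfields

open scoped IntermediateField

theorem numberField_of_finrank_eq_two {K : IntermediateField ℚ ℂ} (h : Module.finrank ℚ K = 2) :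
    NumberField K :=
  have : FiniteDimensional ℚ K := Module.finite_of_finrank_pos (by lia)
  { to_charZero := charZero_of_injective_algebraMap (algebraMap ℚ K).injective
    to_finiteDimensional := this }

theorem intDisc_eq_discr (K : IntermediateField ℚ ℂ) [NumberField K] : intDisc K = discr K := by
  have : FiniteDimensional ℚ K := inferInstance
  rw [intDisc, dif_pos this]

theorem intDisc_congr {K L : IntermediateField ℚ ℂ} [NumberField K] [NumberField L]
    (e : K ≃ₐ[ℚ] L) : intDisc K = intDisc L := by
  rw [intDisc_eq_discr, intDisc_eq_discr, NumberField.discr_eq_discr_of_ringEquiv K e.toRingEquiv]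

theorem IsRealQuadratic.congr {K L : IntermediateField ℚ ℂ} (e : K ≃ₐ[ℚ] L)
    (h : IsRealQuadratic K) : IsRealQuadratic L := by
  refine ⟨e.toLinearEquiv.finrank_eq ▸ h.1, ?_⟩
  rw [← h.2]
  exact Nat.card_congr
    ⟨fun f ↦ f.comp e.toRingEquiv.toRingHom, fun f ↦ f.comp e.symm.toRingEquiv.toRingHom,
      fun f ↦ by ext; simp, fun f ↦ by ext; simp⟩

theorem IsRealQuadratic.intDisc_pos {K : IntermediateField ℚ ℂ} (h : IsRealQuadratic K) :
    0 < intDisc K := by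
  have := numberField_of_finrank_eq_two h.1
  rw [intDisc_eq_discr]
  have : Nonempty (K →+* ℝ) := by
    by_contra h0
    rw [not_nonempty_iff] at h0
    have := h.2
    rw [Nat.card_of_isEmpty] at this
    lia
  exact NumberField.discr_pos_of_realEmbedding h.1 this.some

/-- A quadratic subfield of `ℂ` is determined by its discriminant. -/
theorem eq_of_intDisc_eq {K L : IntermediateField ℚ ℂ} (hK : Module.finrank ℚ K = 2)
    (hL : Module.finrank ℚ L = 2) (h : intDisc K = intDisc L) : K = L := by
  suffices key : ∀ {M : IntermediateField ℚ ℂ}, Module.finrank ℚ M = 2 →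
      ∃ δ : ℂ, δ ^ 2 = intDisc M ∧ M = ℚ⟮δ⟯ by
    obtain ⟨δ, hδ, hδK⟩ := key hK
    obtain ⟨ε, hε, hεL⟩ := key hL
    rw [hδK, hεL]
    rw [h, ← hε] at hδ
    rcases sq_eq_sq_iff_eq_or_eq_neg.1 hδ with rfl | rfl
    · rfl
    · refine le_antisymm ?_ ?_ <;> rw [IntermediateField.adjoin_simple_le_iff]
      · exact neg_mem (IntermediateField.mem_adjoin_simple_self ℚ ε)
      · simpa using neg_mem (IntermediateField.mem_adjoin_simple_self ℚ (-ε))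
  intro M hM
  have := numberField_of_finrank_eq_two hM
  obtain ⟨δ, hδ, hδQ⟩ := NumberField.exists_sq_eq_discr (K := M) hM
  refine ⟨δ, ?_, ?_⟩
  · rw [intDisc_eq_discr]; exact_mod_cast congrArg (algebraMap M ℂ) hδ
  · have hle : ℚ⟮(δ : ℂ)⟯ ≤ M := IntermediateField.adjoin_simple_le_iff.2 δ.2
    have : FiniteDimensional ℚ M := inferInstance
    refine (IntermediateField.eq_of_le_of_finrank_le hle ?_).symm
    rw [hM]
    have hpos : 0 < Module.finrank ℚ ℚ⟮(δ : ℂ)⟯ := by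
      have : FiniteDimensional ℚ ℚ⟮(δ : ℂ)⟯ :=
        Module.Finite.of_injective (IntermediateField.inclusion hle).toLinearMap
          (IntermediateField.inclusion_injective hle)
      exact Module.finrank_pos
    have hne : Module.finrank ℚ ℚ⟮(δ : ℂ)⟯ ≠ 1 := by
      rw [Ne, IntermediateField.finrank_adjoin_simple_eq_one_iff, IntermediateField.mem_bot]
      rintro ⟨r, hr⟩
      exact hδQ ⟨r, Subtype.ext hr⟩
    lia

theorem exists_isRealQuadratic_of_squarefree {d : ℕ} (hd : Squarefree d) (hd1 : d ≠ 1) :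
    ∃ K : IntermediateField ℚ ℂ, IsRealQuadratic K ∧
      ∃ f : ℕ, f ≠ 0 ∧ intDisc K * f ^ 2 = 4 * d := by
  set s : ℂ := ((Real.sqrt d : ℝ) : ℂ) with hs
  have hs2 : s ^ 2 = d := by
    rw [hs]; exact_mod_cast congrArg Complex.ofReal (Real.sq_sqrt (Nat.cast_nonneg d))
  have hnsq : ∀ r : ℚ, r ^ 2 ≠ d := by
    intro r hr
    have : IsSquare d := by
      have : IsSquare ((d : ℕ) : ℚ) := ⟨r, by rw [← hr, sq]⟩
      exact Rat.isSquare_natCast_iff.1 this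
    obtain ⟨k, rfl⟩ := this
    have := hd k dvd_rfl
    rw [Nat.isUnit_iff] at this
    simp [this] at hd1
  have hmonic : (Polynomial.X ^ 2 - Polynomial.C (d : ℚ)).Monic :=
    Polynomial.monic_X_pow_sub_C _ two_ne_zero
  have hirr : Irreducible (Polynomial.X ^ 2 - Polynomial.C (d : ℚ)) :=
    X_pow_sub_C_irreducible_of_prime Nat.prime_two hnsq
  have hmin : minpoly ℚ s = Polynomial.X ^ 2 - Polynomial.C (d : ℚ) := by
    refine (minpoly.eq_of_irreducible_of_monic hirr ?_ hmonic).symm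
    simp [hs2]
  have hint : IsIntegral ℚ s := by
    refine ⟨_, hmonic, ?_⟩
    simp [hs2]
  have hfin : Module.finrank ℚ ℚ⟮s⟯ = 2 := by
    rw [IntermediateField.adjoin.finrank hint, hmin, Polynomial.natDegree_X_pow_sub_C]
  have hmap : (Polynomial.X ^ 2 - Polynomial.C (d : ℚ)).map (algebraMap ℚ ℝ) =
      (Polynomial.X - Polynomial.C (Real.sqrt d)) *
        (Polynomial.X + Polynomial.C (Real.sqrt d)) := by
    have h := congrArg Polynomial.C (Real.sq_sqrt (Nat.cast_nonneg (α := ℝ) d))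
    rw [map_pow] at h
    simp only [Polynomial.map_sub, Polynomial.map_pow, Polynomial.map_X,
      Polynomial.map_natCast, map_natCast] at h ⊢
    linear_combination h
  have hsplit := (Polynomial.Splits.X_sub_C (Real.sqrt d)).mul
    (Polynomial.Splits.X_add_C (Real.sqrt d))
  have := numberField_of_finrank_eq_two hfin
  refine ⟨ℚ⟮s⟯, ⟨hfin, ?_⟩, ?_⟩
  · have hcard := IntermediateField.card_algHom_adjoin_integral ℚ (K := ℝ) hint
      (minpoly.irreducible hint).separable (by rw [hmin, hmap]; exact hsplit)
    rw [hmin, Polynomial.natDegree_X_pow_sub_C] at hcard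
    rw [← hcard]
    exact Nat.card_congr (RingHom.equivRatAlgHom _ _)
  · rw [intDisc_eq_discr]
    refine NumberField.exists_discr_mul_sq_eq hfin hd.ne_zero
      (x := IntermediateField.AdjoinSimple.gen ℚ s) ?_ ?_
    · apply Subtype.ext
      simpa using hs2
    · rintro ⟨r, hr⟩
      have hr' : (r : ℂ) = s := by
        simpa using congrArg (algebraMap ℚ⟮s⟯ ℂ) hr
      apply hnsq r
      rw [← hr'] at hs2
      exact_mod_cast hs2

end Subfields

theorem fieldClass_eq_of_intDisc_toNat_eq {c c' : FieldClass} (hc : IsRealQuadratic c.out)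
    (hc' : IsRealQuadratic c'.out) (h : (intDisc c.out).toNat = (intDisc c'.out).toNat) :
    c = c' := by
  have h1 := hc.intDisc_pos
  have h2 := hc'.intDisc_pos
  rw [← Quotient.out_eq c, ← Quotient.out_eq c', eq_of_intDisc_eq hc.1 hc'.1 (by lia)]

theorem IsRealQuadratic.toNat_intDisc_mem_range {K : IntermediateField ℚ ℂ}
    (h : IsRealQuadratic K) {X : ℝ} (hX : (intDisc K : ℝ) < X) :
    (intDisc K).toNat ∈ Finset.range ⌈X⌉₊ := by
  rw [Finset.mem_range, Nat.lt_ceil]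
  have : ((intDisc K).toNat : ℝ) = intDisc K := by
    exact_mod_cast Int.toNat_of_nonneg h.intDisc_pos.le
  rwa [this]

theorem HasMixedUnit.coprime_toNat_intDisc {K : IntermediateField ℚ ℂ} (h : IsRealQuadratic K)
    (hu : HasMixedUnit K) {Q : ℕ} (hQ : ∀ p : ℕ, p.Prime → p ∣ Q → (p : ZMod 4) = 3) :
    Q.Coprime (intDisc K).toNat := by
  have := numberField_of_finrank_eq_two h.1
  obtain ⟨u, ⟨σ, hσ⟩, τ, hτ⟩ := hu
  refine Nat.Coprime.symm (Nat.coprime_of_dvd fun p hp hpd hpQ ↦ ?_)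
  refine NumberField.mod_four_ne_three_of_dvd_discr h.1 u hσ hτ hp ?_
    ((ZMod.natCast_eq_natCast_iff' p 3 4).1 (hQ p hp hpQ))
  rw [← intDisc_eq_discr, ← Int.toNat_of_nonneg h.intDisc_pos.le]
  exact_mod_cast hpd

theorem classCount_hasMixedUnit_le {Q : ℕ} (hQ0 : Q ≠ 0)
    (hQ : ∀ p : ℕ, p.Prime → p ∣ Q → (p : ZMod 4) = 3) (X : ℝ) :
    classCount (fun K ↦ IsRealQuadratic K ∧ (intDisc K : ℝ) < X ∧ HasMixedUnit K) ≤
      Q.totient * (⌈X⌉₊ / Q + 1) := by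
  refine le_trans ?_ (Nat.Ico_filter_coprime_le 0 ⌈X⌉₊ hQ0)
  rw [← Nat.card_eq_finsetCard]
  refine Nat.card_le_card_of_injective
    (fun c ↦ ⟨(intDisc c.1.out).toNat, ?_⟩) fun c c' h ↦ Subtype.ext ?_
  · have h := c.2
    have hlt := h.1.toNat_intDisc_mem_range h.2.1
    simp only [Finset.mem_filter, Finset.mem_Ico, zero_le, true_and, zero_add]
    exact ⟨Finset.mem_range.1 hlt, h.2.2.coprime_toNat_intDisc h.1 hQ⟩
  · exact fieldClass_eq_of_intDisc_toNat_eq c.2.1 c'.2.1 (congrArg Subtype.val h)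

theorem le_classCount_isRealQuadratic {X : ℝ} (hX : 0 < X) :
    X / 32 - 2 ≤ (classCount fun K ↦ IsRealQuadratic K ∧ (intDisc K : ℝ) < X : ℕ) := by
  have hfinite : Finite {c : FieldClass // IsRealQuadratic c.out ∧ (intDisc c.out : ℝ) < X} :=
    Finite.of_injective (β := Finset.range ⌈X⌉₊)
      (fun c ↦ ⟨(intDisc c.1.out).toNat, c.2.1.toNat_intDisc_mem_range c.2.2⟩)
      fun c c' h ↦ Subtype.ext
        (fieldClass_eq_of_intDisc_toNat_eq c.2.1 c'.2.1 (congrArg Subtype.val h))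
  set T := ((Finset.Ioc 0 ⌊X / 8⌋₊).filter Squarefree).erase 1 with hT
  have hclass : ∀ d : T, ∃ c : {c : FieldClass // IsRealQuadratic c.out ∧
      (intDisc c.out : ℝ) < X}, ∃ f : ℕ, f ≠ 0 ∧ intDisc c.1.out * f ^ 2 = 4 * (d : ℕ) := by
    rintro ⟨d, hd⟩
    simp only [hT, Finset.mem_erase, Finset.mem_filter, Finset.mem_Ioc] at hd
    obtain ⟨hd1, ⟨hd0, hdX⟩, hsq⟩ := hd
    obtain ⟨K, hK, f, hf0, hf⟩ := exists_isRealQuadratic_of_squarefree hsq hd1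
    obtain ⟨e⟩ : Nonempty (K ≃ₐ[ℚ] ((⟦K⟧ : FieldClass).out : IntermediateField ℚ ℂ)) :=
      isoSetoid.symm (Quotient.mk_out K)
    have hout := hK.congr e
    have := numberField_of_finrank_eq_two hK.1
    have := numberField_of_finrank_eq_two hout.1
    have hdisc := intDisc_congr e
    refine ⟨⟨⟦K⟧, hout, ?_⟩, f, hf0, by rw [← hdisc]; exact hf⟩
    have hle : intDisc K ≤ 4 * d := by
      have : (1 : ℤ) ≤ (f : ℤ) ^ 2 := by exact_mod_cast Nat.one_le_pow 2 f (by lia)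
      nlinarith [hK.intDisc_pos]
    have hle' : (intDisc K : ℝ) ≤ 4 * d := by exact_mod_cast hle
    have hd' : (d : ℝ) ≤ X / 8 := (Nat.le_floor_iff (by positivity)).1 hdX
    rw [← hdisc]
    linarith
  choose F hF using hclass
  have hinj : Function.Injective F := by
    intro d d' h
    obtain ⟨f, hf0, hf⟩ := hF d
    obtain ⟨f', hf0', hf'⟩ := hF d'
    rw [h] at hf
    have hd := (Finset.mem_filter.1 (Finset.mem_of_mem_erase d.2)).2
    have hd' := (Finset.mem_filter.1 (Finset.mem_of_mem_erase d'.2)).2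
    refine Subtype.ext (eq_of_squarefree_of_mul_sq_eq hd hd' hf0' hf0 ?_)
    have : (4 : ℤ) * ((d : ℕ) * f' ^ 2) = 4 * ((d' : ℕ) * f ^ 2) := by
      linear_combination f ^ 2 * hf' - f' ^ 2 * hf
    have := mul_left_cancel₀ four_ne_zero this
    exact_mod_cast this
  have hcard := Nat.card_le_card_of_injective F hinj
  rw [Nat.card_eq_finsetCard] at hcard
  have hcard' : ((Finset.Ioc 0 ⌊X / 8⌋₊).filter Squarefree).card ≤
      classCount (fun K ↦ IsRealQuadratic K ∧ (intDisc K : ℝ) < X) + 1 :=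
    Nat.sub_le_iff_le_add.1 (Finset.pred_card_le_card_erase.trans hcard)
  have hcardR : (((Finset.Ioc 0 ⌊X / 8⌋₊).filter Squarefree).card : ℝ) ≤
      (classCount (fun K ↦ IsRealQuadratic K ∧ (intDisc K : ℝ) < X) : ℕ) + 1 := by
    exact_mod_cast hcard'
  have := div_four_le_card_squarefree ⌊X / 8⌋₊
  have := Nat.lt_floor_add_one (X / 8)
  linarith

/-- When real quadratic fields are ordered by discriminant, a density of `0%`
of them have a unit of mixed signature. -/
theorem real_quadratic_mixed_unit_density_zero :
    Filter.Tendsto (fun X : ℝ =>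
      (classCount (fun K => IsRealQuadratic K ∧ (intDisc K : ℝ) < X ∧ HasMixedUnit K) : ℝ) /
      (classCount (fun K => IsRealQuadratic K ∧ (intDisc K : ℝ) < X) : ℝ))
      Filter.atTop (nhds 0) := by
  rw [Metric.tendsto_atTop]
  intro ε hε
  obtain ⟨Q, hQ0, hQ, htot⟩ := exists_totient_le_mul (q := 4) (a := 3) (by decide)
    (show 0 < ε / 512 by positivity)
  have hQpos : (0 : ℝ) < Q := by exact_mod_cast Nat.pos_of_ne_zero hQ0
  refine ⟨max 128 (1 + Q), fun X hX ↦ ?_⟩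
  have hX1 : 128 ≤ X := (le_max_left _ _).trans hX
  have hX2 : 1 + (Q : ℝ) ≤ X := (le_max_right _ _).trans hX
  have hden := le_classCount_isRealQuadratic (show 0 < X by linarith)
  set D : ℕ := classCount fun K ↦ IsRealQuadratic K ∧ (intDisc K : ℝ) < X
  have hnum := classCount_hasMixedUnit_le hQ0 hQ X
  set M : ℕ := classCount fun K ↦ IsRealQuadratic K ∧ (intDisc K : ℝ) < X ∧ HasMixedUnit K
  have hDpos : (0 : ℝ) < D := by linarith
  have hnumR : (M : ℝ) ≤ ε / 512 * Q * ((X + 1) / Q + 1) := by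
    calc (M : ℝ) ≤ Q.totient * ((⌈X⌉₊ / Q : ℕ) + 1) := by exact_mod_cast hnum
      _ ≤ _ := by
        gcongr
        refine Nat.cast_div_le.trans ?_
        gcongr
        exact (Nat.ceil_lt_add_one (by linarith)).le
  have hnumR' : (M : ℝ) ≤ ε / 512 * (X + 1 + Q) := by
    refine hnumR.trans_eq ?_
    field_simp
  rw [dist_zero_right, Real.norm_of_nonneg (by positivity), div_lt_iff₀ hDpos]
  nlinarith
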